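/- arXiv:1704.02086 — 5 statements merged into one kernel-verified Lean document; each statement's English description precedes it below -/
import Mathlib

section
/- Let F be a field, let m, k, d, d' be natural numbers with m, k ≥ 1, and let G, K, L be finite subsets of F with K ⊆ L, d' ≥ |G| − 2, and |K| = d + 1. Let 𝒫 denote the F-vector space of polynomials Z(X₁,…,X_m,Y₁,…,Y_k) over F having individual degree at most d in each X-variable and at most d' in each Y-variable. Suppose S is a finite subset of F^{m+k}, ℓ ≥ 1, and there are matrices C : L^m × {1,…,ℓ} → F and D : S × {1,…,ℓ} → F such that for every Z ∈ 𝒫 and every i ∈ {1,…,ℓ}: Σ_{α ∈ L^m} C_{α,i} · Σ_{y ∈ G^k} Z(α, y) = Σ_{q ∈ S} D_{q,i} · Z(q). Let B : K^m × L^m → F be the matrix uniquely determined by the property that for every m-variate polynomial W over F of individual degree at most d and every α ∈ L^m one has W(α) = Σ_{β ∈ K^m} B_{β,α} · W(β) (such B exists and is unique since the evaluation functionals at the points of K^m form a basis of the dual of the space of such W, as |K| = d + 1). Then |S| ≥ rank(B·C) · (min{d' − |G| + 2, |G|})^k. -/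
open MvPolynomial Finset

/-- The product over all variables of univariate polynomials `p s` in the variable `X s`. -/
noncomputable def MvPolynomial.prodUnivariate {σ F : Type*} [Fintype σ] [Field F]
    (p : σ → Polynomial F) : MvPolynomial σ F :=
  ∏ s, Polynomial.aeval (X s) (p s)

theorem MvPolynomial.eval_prodUnivariate {σ F : Type*} [Fintype σ] [Field F]
    (p : σ → Polynomial F) (x : σ → F) :
    eval x (prodUnivariate p) = ∏ s, (p s).eval (x s) := by
  simp [prodUnivariate, Polynomial.aeval_def, Polynomial.eval₂_eq_sum_range,
    Polynomial.eval_eq_sum_range, algebraMap_eq]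

theorem MvPolynomial.degreeOf_prodUnivariate_le {σ F : Type*} [Fintype σ] [Field F]
    (p : σ → Polynomial F) (s : σ) :
    (prodUnivariate p).degreeOf s ≤ (p s).natDegree := by
  refine (degreeOf_prod_le _ _ _).trans ?_
  rw [Finset.sum_eq_single_of_mem s (Finset.mem_univ s)]
  · rw [Polynomial.aeval_eq_sum_range]
    refine (degreeOf_sum_le _ _ _).trans (Finset.sup_le fun n hn => ?_)
    rw [smul_eq_C_mul]
    refine (degreeOf_C_mul_le _ _ _).trans ?_
    rw [degreeOf_X_self_pow]
    exact Nat.lt_succ_iff.mp (Finset.mem_range.mp hn)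
  · intro t _ hts
    rw [Polynomial.aeval_eq_sum_range, ← Nat.le_zero]
    refine (degreeOf_sum_le _ _ _).trans (Finset.sup_le fun n _ => ?_)
    rw [smul_eq_C_mul]
    refine (degreeOf_C_mul_le _ _ _).trans ?_
    rw [degreeOf_X_pow_of_ne n hts.symm]

theorem Lagrange.eval_basis_id {F : Type*} [Field F] [DecidableEq F] (K : Finset F)
    {a b : F} (ha : a ∈ K) (hb : b ∈ K) :
    (Lagrange.basis K id a).eval b = if a = b then 1 else 0 := by
  split_ifs with h
  · subst h
    exact Lagrange.eval_basis_self (v := id) (Set.injOn_id _) ha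
  · exact Lagrange.eval_basis_of_ne (v := id) h hb

theorem Lagrange.prod_eval_basis_id {ι F : Type*} [Fintype ι] [Field F] [DecidableEq F]
    (K : Finset F) {a b : ι → F} (ha : ∀ i, a i ∈ K) (hb : ∀ i, b i ∈ K) :
    ∏ i, (Lagrange.basis K id (a i)).eval (b i) = if a = b then 1 else 0 := by
  simp_rw [Lagrange.eval_basis_id K (ha _) (hb _), Fintype.prod_boole, funext_iff]

/-- The Lagrange basis polynomials on a grid `G ^ ι` pick out a single term of a sum over it. -/
theorem Lagrange.sum_piFinset_prod_mul_eval_basis_id {ι F : Type*} [Fintype ι] [DecidableEq ι]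
    [Field F] [DecidableEq F] (G : Finset F) (f : ι → F → F) {b : ι → F} (hb : ∀ i, b i ∈ G) :
    ∑ y ∈ Fintype.piFinset (fun _ : ι => G),
      ∏ i, (f i (y i) * (Lagrange.basis G id (b i)).eval (y i)) = ∏ i, f i (b i) := by
  have hbG : b ∈ Fintype.piFinset (fun _ : ι => G) := Fintype.mem_piFinset.mpr hb
  rw [Finset.sum_eq_single_of_mem b hbG]
  · rw [Finset.prod_mul_distrib, Lagrange.prod_eval_basis_id G hb hb, if_pos rfl, mul_one]
  · intro y hy hyb
    rw [Finset.prod_mul_distrib, Lagrange.prod_eval_basis_id G hb (Fintype.mem_piFinset.mp hy),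
      if_neg hyb.symm, mul_zero]

theorem Matrix.rank_mul_card_le_rank_blockDiagonal {m n o F : Type*} [Fintype m] [Fintype n]
    [Fintype o] [DecidableEq o] [Field F] (M : Matrix m n F) :
    M.rank * Fintype.card o ≤ (Matrix.blockDiagonal fun _ : o => M).rank := by
  let N : Matrix (m × o) (n × o) F := Matrix.blockDiagonal fun _ : o => M
  let e : (o → LinearMap.range M.mulVecLin) →ₗ[F] (m × o → F) :=
    { toFun := fun g p => (g p.2 : m → F) p.1
      map_add' := fun _ _ => rfl
      map_smul' := fun _ _ => rfl }
  have he : ∀ g, e g ∈ LinearMap.range N.mulVecLin := by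
    intro g
    choose v hv using fun a => (g a).2
    refine ⟨fun p => v p.2 p.1, ?_⟩
    ext ⟨i, a⟩
    have h := congrFun (hv a) i
    simp only [Matrix.mulVecLin_apply, Matrix.mulVec, dotProduct] at h ⊢
    simp [N, Matrix.blockDiagonal_apply, Fintype.sum_prod_type, e, ← h]
  have hinj : Function.Injective (e.codRestrict _ he) := by
    intro g g' h
    ext a i
    exact congrFun (congrArg Subtype.val h) (i, a)
  have h := LinearMap.finrank_le_finrank_of_injective hinj
  rw [Module.finrank_pi_fintype, Finset.sum_const, Finset.card_univ, smul_eq_mul, mul_comm] at h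
  exact h

/-- **Algebraic query complexity of polynomial summation** (Theorem 5.1 / `thm:sum-query-lower-bound`).
If linear combinations (given by a matrix `C`) of the sums `∑_{y ∈ G^k} Z(α, y)` over `α ∈ L^m`
can be computed from the evaluations of `Z` at a query set `S` (via a matrix `D`), uniformly over
all polynomials `Z` of individual degree `≤ d` in the `X`-variables and `≤ d'` in the
`Y`-variables, then `|S| ≥ rank(B·C) · (min{d' − |G| + 2, |G|})^k`, where `B` is the change-of-basis
matrix expressing evaluation at points of `L^m` in terms of evaluation at points of `K^m`
for `m`-variate polynomials of individual degree at most `d`. -/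
theorem sum_query_lower_bound
    (F : Type*) [Field F]
    (m k d d' : ℕ) (hm : 1 ≤ m) (hk : 1 ≤ k)
    (G K L : Finset F) (hKL : K ⊆ L) (hd' : G.card - 2 ≤ d') (hKcard : K.card = d + 1)
    (S : Finset ((Fin m → F) × (Fin k → F))) (ℓ : ℕ) (hℓ : 1 ≤ ℓ)
    (C : Matrix {α // α ∈ Fintype.piFinset (fun _ : Fin m => L)} (Fin ℓ) F)
    (D : Matrix {q // q ∈ S} (Fin ℓ) F)
    (hCD : ∀ Z : MvPolynomial (Fin m ⊕ Fin k) F,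
      (∀ i : Fin m, Z.degreeOf (Sum.inl i) ≤ d) →
      (∀ j : Fin k, Z.degreeOf (Sum.inr j) ≤ d') →
      ∀ i : Fin ℓ,
        ∑ α : {α // α ∈ Fintype.piFinset (fun _ : Fin m => L)},
          C α i * ∑ y ∈ Fintype.piFinset (fun _ : Fin k => G),
            MvPolynomial.eval (Sum.elim (α : Fin m → F) y) Z
        = ∑ q : {q // q ∈ S},
            D q i * MvPolynomial.eval
              (Sum.elim (q : (Fin m → F) × (Fin k → F)).1
                        (q : (Fin m → F) × (Fin k → F)).2) Z)
    (B : Matrix {β // β ∈ Fintype.piFinset (fun _ : Fin m => K)}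
                {α // α ∈ Fintype.piFinset (fun _ : Fin m => L)} F)
    (hB : ∀ W : MvPolynomial (Fin m) F, (∀ i : Fin m, W.degreeOf i ≤ d) →
      ∀ α : {α // α ∈ Fintype.piFinset (fun _ : Fin m => L)},
        MvPolynomial.eval (α : Fin m → F) W
        = ∑ β : {β // β ∈ Fintype.piFinset (fun _ : Fin m => K)},
            B β α * MvPolynomial.eval (β : Fin m → F) W) :
    (B * C).rank * (min (d' + 2 - G.card) G.card) ^ k ≤ S.card := by
  classical
  set r := min (d' + 2 - G.card) G.card with hr
  obtain hr0 | hr0 := Nat.eq_zero_or_pos r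
  · rw [hr0, zero_pow (by lia), mul_zero]
    exact Nat.zero_le _
  obtain ⟨H, hHG, hHcard⟩ := Finset.exists_subset_card_eq (show r ≤ G.card from min_le_right _ _)
  let Q (β : {β // β ∈ Fintype.piFinset (fun _ : Fin m => K)}) (a b : Fin k → H) :
      Fin m ⊕ Fin k → Polynomial F :=
    Sum.elim (fun i => Lagrange.basis K id (β.1 i))
      (fun j => Lagrange.basis H id (a j).1 * Lagrange.basis G id (b j).1)
  have hKdeg (β : {β // β ∈ Fintype.piFinset (fun _ : Fin m => K)}) (i : Fin m) :
      (Lagrange.basis K id (β.1 i)).natDegree ≤ d := by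
    rw [Lagrange.natDegree_basis (Set.injOn_id _) (Fintype.mem_piFinset.mp β.2 i), hKcard,
      Nat.add_sub_cancel]
  have hYdeg (a b : H) :
      (Lagrange.basis H id a.1 * Lagrange.basis G id b.1).natDegree ≤ d' := by
    refine Polynomial.natDegree_mul_le.trans ?_
    rw [Lagrange.natDegree_basis (Set.injOn_id _) a.2,
      Lagrange.natDegree_basis (Set.injOn_id _) (hHG b.2), hHcard]
    lia
  have hBeval (β : {β // β ∈ Fintype.piFinset (fun _ : Fin m => K)})
      (α : {α // α ∈ Fintype.piFinset (fun _ : Fin m => L)}) :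
      ∏ i, (Lagrange.basis K id (β.1 i)).eval (α.1 i) = B β α := by
    have h := hB (prodUnivariate fun i => Lagrange.basis K id (β.1 i))
      (fun i => (degreeOf_prodUnivariate_le _ i).trans (hKdeg β i)) α
    simp_rw [eval_prodUnivariate] at h
    rw [h, Finset.sum_eq_single_of_mem β (Finset.mem_univ β)]
    · rw [Lagrange.prod_eval_basis_id K (Fintype.mem_piFinset.mp β.2)
        (Fintype.mem_piFinset.mp β.2), if_pos rfl, mul_one]
    · intro γ _ hγ
      rw [Lagrange.prod_eval_basis_id K (Fintype.mem_piFinset.mp β.2)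
        (Fintype.mem_piFinset.mp γ.2), if_neg fun h => hγ (Subtype.ext h.symm), mul_zero]
  let E : Matrix ({β // β ∈ Fintype.piFinset (fun _ : Fin m => K)} × (Fin k → H))
      {q // q ∈ S} F := Matrix.of fun p q =>
    (∏ i, (Lagrange.basis K id (p.1.1 i)).eval (q.1.1 i)) *
      ∏ j, (Lagrange.basis H id (p.2 j).1).eval (q.1.2 j)
  let N : Matrix {q // q ∈ S} (Fin ℓ × (Fin k → H)) F := Matrix.of fun q p =>
    D q p.1 * ∏ j, (Lagrange.basis G id (p.2 j).1).eval (q.1.2 j)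
  have hEN : E * N = Matrix.blockDiagonal fun _ : Fin k → H => B * C := by
    ext ⟨β, a⟩ ⟨i, b⟩
    have h := hCD (prodUnivariate (Q β a b))
      (fun i => (degreeOf_prodUnivariate_le _ _).trans (hKdeg β i))
      (fun j => (degreeOf_prodUnivariate_le _ _).trans (hYdeg (a j) (b j))) i
    simp only [eval_prodUnivariate, Fintype.prod_sum_type, Q, Sum.elim_inl, Sum.elim_inr,
      Polynomial.eval_mul, ← Finset.mul_sum, hBeval] at h
    rw [Lagrange.sum_piFinset_prod_mul_eval_basis_id G
      (fun j y => (Lagrange.basis H id (a j).1).eval y) (fun j => hHG (b j).2),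
      Lagrange.prod_eval_basis_id H (fun j => (a j).2) (fun j => (b j).2)] at h
    have hab : (fun j => (a j).1) = (fun j => (b j).1) ↔ a = b := by
      simp only [funext_iff, Subtype.ext_iff]
    simp only [hab] at h
    rw [Matrix.blockDiagonal_apply, Matrix.mul_apply, Matrix.mul_apply]
    calc ∑ q, E (β, a) q * N q (i, b)
        = ∑ α, C α i * (B β α * if a = b then 1 else 0) := by
          rw [h]
          refine Finset.sum_congr rfl fun q _ => ?_
          simp only [E, N, Matrix.of_apply, Finset.prod_mul_distrib]
          ring
      _ = if a = b then ∑ α, B β α * C α i else 0 := by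
          split_ifs <;> simp [mul_comm]
  calc (B * C).rank * r ^ k = (B * C).rank * Fintype.card (Fin k → H) := by simp [hHcard]
    _ ≤ (Matrix.blockDiagonal fun _ : Fin k → H => B * C).rank :=
        Matrix.rank_mul_card_le_rank_blockDiagonal _
    _ ≤ E.rank := hEN ▸ Matrix.rank_mul_le_left E N
    _ ≤ S.card := by simpa using E.rank_le_card_width
end

section
/- Let F be a finite field, G a subset of F, m, k ≥ 1, and d, d' natural numbers with d' ≥ 2(|G| − 1). Let 𝒫 denote the space of polynomials Z(X₁,…,X_m,Y₁,…,Y_k) over F of individual degree at most d in each X-variable and at most d' in each Y-variable. Suppose S ⊆ F^{m+k} is a finite set and there exist coefficients (c_α)_{α ∈ F^m} and (d_q)_{q ∈ S} in F such that: (i) for every Z ∈ 𝒫, Σ_{α ∈ F^m} c_α · Σ_{y ∈ G^k} Z(α, y) = Σ_{q ∈ S} d_q · Z(q); and (ii) there exists Z' ∈ 𝒫 with Σ_{α ∈ F^m} c_α · Σ_{y ∈ G^k} Z'(α, y) ≠ 0. Then |S| ≥ |G|^k. -/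
open MvPolynomial Finset

theorem MvPolynomial.degreeOf_aeval_X_le {σ R : Type*} [CommSemiring R] [DecidableEq σ]
    (i j : σ) (p : Polynomial R) :
    (Polynomial.aeval (X j : MvPolynomial σ R) p).degreeOf i ≤ if i = j then p.natDegree else 0 := by
  rw [Polynomial.aeval_eq_sum_range]
  refine (degreeOf_sum_le _ _ _).trans (Finset.sup_le fun n hn => ?_)
  rw [smul_eq_C_mul]
  refine (degreeOf_C_mul_le _ _ _).trans ?_
  split_ifs with h
  · subst h
    rcases subsingleton_or_nontrivial R with hR | hR
    · simp [Subsingleton.elim (X i ^ n : MvPolynomial σ R) 0]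
    · rw [degreeOf_X_self_pow]
      exact Nat.lt_succ_iff.mp (Finset.mem_range.mp hn)
  · refine (degreeOf_pow_le _ _ _).trans ?_
    rw [degreeOf_X_of_ne h, mul_zero]

/-- The polynomial in the right-hand variables that interpolates the indicator of `y` on the grid
`G ^ k`. -/
noncomputable def gridBasis {F : Type*} [Field F] [DecidableEq F] (G : Finset F) (m : ℕ) {k : ℕ}
    (y : Fin k → F) : MvPolynomial (Fin m ⊕ Fin k) F :=
  ∏ j, Polynomial.aeval (X (Sum.inr j)) (Lagrange.basis G id (y j))

section gridBasis

variable {F : Type*} [Field F] [DecidableEq F] {G : Finset F} {m k : ℕ}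

theorem degreeOf_inl_gridBasis (y : Fin k → F) (i : Fin m) :
    (gridBasis G m y).degreeOf (Sum.inl i) = 0 := by
  refine Nat.le_zero.mp ((degreeOf_prod_le _ _ _).trans ?_)
  refine (Finset.sum_le_sum fun j _ => degreeOf_aeval_X_le _ _ _).trans ?_
  simp

theorem degreeOf_inr_gridBasis_le {y : Fin k → F} (hy : ∀ j, y j ∈ G) (j : Fin k) :
    (gridBasis G m y).degreeOf (Sum.inr j) ≤ G.card - 1 := by
  refine (degreeOf_prod_le _ _ _).trans ?_
  refine (Finset.sum_le_sum fun j _ => degreeOf_aeval_X_le _ _ _).trans ?_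
  simp only [Sum.inr.injEq, Finset.sum_ite_eq, Finset.mem_univ, if_true]
  exact (Polynomial.natDegree_eq_of_degree_eq_some
    (Lagrange.degree_basis Function.injective_id.injOn (hy j))).le

theorem eval_gridBasis {y z : Fin k → F} (hy : ∀ j, y j ∈ G) (hz : ∀ j, z j ∈ G)
    (α : Fin m → F) :
    eval (Sum.elim α z) (gridBasis G m y) = if y = z then 1 else 0 := by
  have h : ∀ (p : Polynomial F) (j : Fin k),
      eval (Sum.elim α z) (Polynomial.aeval (X (Sum.inr j)) p) = p.eval (z j) := by
    intro p j
    simpa [Polynomial.aeval_def] using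
      (Polynomial.aeval_algHom_apply (MvPolynomial.aeval (Sum.elim α z) : _ →ₐ[F] F)
        (X (Sum.inr j)) p).symm
  simp only [gridBasis, map_prod, h]
  split_ifs with hyz
  · subst hyz
    exact Finset.prod_eq_one fun j _ =>
      Lagrange.eval_basis_self (v := id) Function.injective_id.injOn (hy j)
  · obtain ⟨j, hj⟩ := Function.ne_iff.mp hyz
    exact Finset.prod_eq_zero (Finset.mem_univ j)
      (Lagrange.eval_basis_of_ne (v := id) hj (hz j))

end gridBasis

/-- Corollary 5.2 (`cor:special-case-query`): over a finite field `F`, if some nontrivial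
linear combination of the partial sums `∑_{y ∈ G^k} Z(α, y)` (over all `α ∈ F^m`) can be
computed as a linear combination of evaluations of `Z` at points of `S`, uniformly over all
polynomials `Z` of individual degree `≤ d` in the `X`-variables and `≤ d' ≥ 2(|G|−1)` in the
`Y`-variables, then `|S| ≥ |G|^k`. -/
theorem special_case_query_lower_bound
    (F : Type*) [Field F] [Fintype F]
    (G : Finset F) (m k : ℕ) (hm : 1 ≤ m) (hk : 1 ≤ k)
    (d d' : ℕ) (hd' : 2 * (G.card - 1) ≤ d')
    (S : Finset ((Fin m → F) × (Fin k → F)))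
    (c : (Fin m → F) → F) (dd : (Fin m → F) × (Fin k → F) → F)
    (h1 : ∀ Z : MvPolynomial (Fin m ⊕ Fin k) F,
      (∀ i : Fin m, Z.degreeOf (Sum.inl i) ≤ d) →
      (∀ j : Fin k, Z.degreeOf (Sum.inr j) ≤ d') →
      ∑ α : Fin m → F, c α * ∑ y ∈ Fintype.piFinset (fun _ : Fin k => G),
          MvPolynomial.eval (Sum.elim α y) Z
      = ∑ q ∈ S, dd q * MvPolynomial.eval (Sum.elim q.1 q.2) Z)
    (h2 : ∃ Z' : MvPolynomial (Fin m ⊕ Fin k) F,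
      (∀ i : Fin m, Z'.degreeOf (Sum.inl i) ≤ d) ∧
      (∀ j : Fin k, Z'.degreeOf (Sum.inr j) ≤ d') ∧
      ∑ α : Fin m → F, c α * ∑ y ∈ Fintype.piFinset (fun _ : Fin k => G),
          MvPolynomial.eval (Sum.elim α y) Z' ≠ 0) :
    G.card ^ k ≤ S.card := by
  classical
  by_contra! hS
  obtain ⟨Z', hX, -, hne⟩ := h2
  obtain ⟨s, hs, hcs⟩ : ∃ s ∈ Z'.support,
      ∑ α : Fin m → F, c α * ∏ i, α i ^ s (Sum.inl i) ≠ 0 := by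
    by_contra! hzero
    refine hne ?_
    have key : ∀ α : Fin m → F,
        c α * ∑ y ∈ Fintype.piFinset (fun _ : Fin k => G), eval (Sum.elim α y) Z' =
        ∑ s ∈ Z'.support, (c α * ∏ i, α i ^ s (Sum.inl i)) *
          ∑ y ∈ Fintype.piFinset (fun _ : Fin k => G),
            Z'.coeff s * ∏ j, y j ^ s (Sum.inr j) := by
      intro α
      simp only [eval_eq', Fintype.prod_sum_type, Sum.elim_inl, Sum.elim_inr]
      rw [Finset.sum_comm, Finset.mul_sum]
      refine Finset.sum_congr rfl fun s _ => ?_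
      rw [Finset.mul_sum, Finset.mul_sum]
      refine Finset.sum_congr rfl fun y _ => ?_
      ring
    simp only [key]
    rw [Finset.sum_comm]
    refine Finset.sum_eq_zero fun s hs => ?_
    rw [← Finset.sum_mul, hzero s hs, zero_mul]
  set grid := Fintype.piFinset (fun _ : Fin k => G) with hgrid
  have hmem : ∀ y ∈ grid, ∀ j, y j ∈ G := fun y hy => Fintype.mem_piFinset.mp hy
  let M : Matrix S grid F := fun q y => eval (Sum.elim q.1.1 q.1.2) (gridBasis G m y.1)
  have hker : LinearMap.ker M.mulVecLin ≠ ⊥ := by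
    apply LinearMap.ker_ne_bot_of_finrank_lt
    rw [Module.finrank_fintype_fun_eq_card, Module.finrank_fintype_fun_eq_card,
      Fintype.card_coe, Fintype.card_coe, hgrid, Fintype.card_piFinset]
    simpa using hS
  obtain ⟨f, hf, hf0⟩ := Submodule.exists_mem_ne_zero_of_ne_bot hker
  obtain ⟨⟨y₀, hy₀⟩, hfy₀⟩ := Function.ne_iff.mp hf0
  let P : MvPolynomial (Fin m ⊕ Fin k) F := ∏ i, X (Sum.inl i) ^ s (Sum.inl i)
  let U : MvPolynomial (Fin m ⊕ Fin k) F := ∑ y : grid, C (f y) * gridBasis G m y.1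
  have hPdeg : ∀ t, P.degreeOf t ≤
      ∑ i, s (Sum.inl i) * if t = Sum.inl i then 1 else 0 := by
    intro t
    refine (degreeOf_prod_le _ _ _).trans (Finset.sum_le_sum fun i _ => ?_)
    refine (degreeOf_pow_le _ _ _).trans ?_
    rw [degreeOf_X]
  have hUl : ∀ i, U.degreeOf (Sum.inl i) ≤ 0 := fun i =>
    (degreeOf_sum_le _ _ _).trans <| Finset.sup_le fun y _ =>
      (degreeOf_C_mul_le _ _ _).trans (degreeOf_inl_gridBasis _ _).le
  have hUr : ∀ j, U.degreeOf (Sum.inr j) ≤ G.card - 1 := fun j =>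
    (degreeOf_sum_le _ _ _).trans <| Finset.sup_le fun y _ =>
      (degreeOf_C_mul_le _ _ _).trans (degreeOf_inr_gridBasis_le (hmem _ y.2) _)
  have heq := h1 (P * (U * gridBasis G m y₀)) ?_ ?_
  · have hright : ∑ q ∈ S, dd q *
        eval (Sum.elim q.1 q.2) (P * (U * gridBasis G m y₀)) = 0 := by
      refine Finset.sum_eq_zero fun q hq => ?_
      have hU : eval (Sum.elim q.1 q.2) U = 0 := by
        have h := congrFun (LinearMap.mem_ker.mp hf) ⟨q, hq⟩
        rw [Matrix.mulVecLin_apply] at h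
        simpa [M, U, Matrix.mulVec, dotProduct, mul_comm] using h
      simp [hU]
    have hleft : ∀ α : Fin m → F, ∑ y ∈ grid,
        eval (Sum.elim α y) (P * (U * gridBasis G m y₀)) =
        (∏ i, α i ^ s (Sum.inl i)) * f ⟨y₀, hy₀⟩ := by
      intro α
      rw [Finset.sum_eq_single_of_mem y₀ hy₀]
      · have hU : eval (Sum.elim α y₀) U = f ⟨y₀, hy₀⟩ := by
          simp only [U, map_sum, map_mul, eval_C]
          rw [Finset.sum_eq_single_of_mem ⟨y₀, hy₀⟩ (Finset.mem_univ _)]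
          · simp [eval_gridBasis (hmem _ hy₀) (hmem _ hy₀)]
          · intro y _ hy
            rw [eval_gridBasis (hmem _ y.2) (hmem _ hy₀), if_neg, mul_zero]
            exact fun h => hy (Subtype.ext h)
        rw [map_mul, map_mul, hU, eval_gridBasis (hmem _ hy₀) (hmem _ hy₀)]
        simp [P]
      · intro y hy hne
        rw [map_mul, map_mul, eval_gridBasis (hmem _ hy₀) (hmem _ hy), if_neg hne.symm,
          mul_zero, mul_zero]
    rw [hright] at heq
    simp only [hleft] at heq
    simp only [← mul_assoc, ← Finset.sum_mul] at heq
    exact mul_ne_zero hcs hfy₀ heq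
  · intro i
    have hP : P.degreeOf (Sum.inl i) ≤ s (Sum.inl i) := by simpa using hPdeg (Sum.inl i)
    have hsd : s (Sum.inl i) ≤ d := (monomial_le_degreeOf _ hs).trans (hX i)
    have h₁ := degreeOf_mul_le (Sum.inl i) P (U * gridBasis G m y₀)
    have h₂ := degreeOf_mul_le (Sum.inl i) U (gridBasis G m y₀)
    have h₃ := hUl i
    have h₄ := degreeOf_inl_gridBasis (G := G) y₀ i
    omega
  · intro j
    have hP : P.degreeOf (Sum.inr j) ≤ 0 := by simpa using hPdeg (Sum.inr j)
    have h₁ := degreeOf_mul_le (Sum.inr j) P (U * gridBasis G m y₀)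
    have h₂ := degreeOf_mul_le (Sum.inr j) U (gridBasis G m y₀)
    have h₃ := hUr j
    have h₄ := degreeOf_inr_gridBasis_le (m := m) (hmem _ hy₀) j
    omega
end

section
/- Let F be a finite field and D a finite set. Let V ⊆ F^D be an F-linear subspace, and let v be a uniformly random element of V. For any subsets S, S' ⊆ D, the restrictions v|_S = (v_i)_{i ∈ S} and v|_{S'} = (v_i)_{i ∈ S'} are statistically dependent (i.e., NOT independent as random variables) if and only if there exist constants (c_i)_{i ∈ S} and (d_i)_{i ∈ S'} in F such that: (i) there exists w ∈ V with Σ_{i ∈ S} c_i · w_i ≠ 0, and (ii) for all w ∈ V, Σ_{i ∈ S} c_i · w_i = Σ_{i ∈ S'} d_i · w_i. -/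
open Finset

/-- The vectors of `V` whose coordinates in `S` vanish. -/
def vanishingOn {F D : Type*} [Field F] (V : Submodule F (D → F)) (S : Finset D) :
    Submodule F (D → F) :=
  V ⊓ Submodule.pi (S : Set D) fun _ => ⊥

theorem mem_vanishingOn {F D : Type*} [Field F] {V : Submodule F (D → F)} {S : Finset D}
    {v : D → F} : v ∈ vanishingOn V S ↔ v ∈ V ∧ ∀ i ∈ S, v i = 0 := by
  simp [vanishingOn, Submodule.mem_pi]

theorem card_eq_card_of_iff_sub_mem {R M : Type*} [Ring R] [AddCommGroup M] [Module R M]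
    (K : Submodule R M) (a : M) {P : M → Prop} (h : ∀ v, P v ↔ v - a ∈ K) :
    Nat.card {v // P v} = Nat.card K :=
  Nat.card_congr ((Equiv.subRight a).subtypeEquiv h)

theorem card_sup_mul_card_inf {F E : Type*} [Field F] [Fintype F] [AddCommGroup E] [Module F E]
    [FiniteDimensional F E] (K L : Submodule F E) :
    Nat.card ↥(K ⊔ L) * Nat.card ↥(K ⊓ L) = Nat.card K * Nat.card L := by
  rw [Module.natCard_eq_pow_finrank (K := F) (V := ↥(K ⊔ L)),
    Module.natCard_eq_pow_finrank (K := F) (V := ↥(K ⊓ L)),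
    Module.natCard_eq_pow_finrank (K := F) (V := K),
    Module.natCard_eq_pow_finrank (K := F) (V := L), ← pow_add, ← pow_add,
    Submodule.finrank_sup_add_finrank_inf_eq]

/-- A functional vanishing on the vectors of `V` that are zero on `S` is, on `V`, a linear
combination of the coordinates in `S`. -/
theorem exists_coeff_of_vanishingOn_le_ker {F D : Type*} [Field F] (V : Submodule F (D → F))
    (S : Finset D) (f : (D → F) →ₗ[F] F) (hf : vanishingOn V S ≤ LinearMap.ker f) :
    ∃ c : D → F, ∀ w ∈ V, ∑ i ∈ S, c i * w i = f w := by
  classical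
  have hspan : f.domRestrict V ∈ Submodule.span F (Set.range fun i : S =>
      (LinearMap.proj (R := F) (φ := fun _ : D => F) (i : D)).domRestrict V) := by
    apply mem_span_of_iInf_ker_le_ker
    intro w hw
    simp only [Submodule.mem_iInf, LinearMap.mem_ker, LinearMap.domRestrict_apply,
      LinearMap.proj_apply] at hw ⊢
    exact hf (mem_vanishingOn.2 ⟨w.2, fun i hi => hw ⟨i, hi⟩⟩)
  obtain ⟨c, hc⟩ := (Submodule.mem_span_range_iff_exists_fun F).1 hspan
  refine ⟨fun i => if hi : i ∈ S then c ⟨i, hi⟩ else 0, fun w hw => ?_⟩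
  have h := LinearMap.congr_fun hc ⟨w, hw⟩
  simp only [LinearMap.sum_apply, LinearMap.smul_apply, LinearMap.domRestrict_apply,
    LinearMap.proj_apply, smul_eq_mul] at h
  rw [← h, ← Finset.sum_coe_sort S]
  simp

theorem card_mul_card_eq_of_le_sup {F D : Type*} [Field F] [Fintype F] [Fintype D]
    (V : Submodule F (D → F)) (S S' : Finset D)
    (hV : V ≤ vanishingOn V S ⊔ vanishingOn V S') (x y : D → F) :
    Nat.card {v : D → F // v ∈ V ∧ (∀ i ∈ S, v i = x i) ∧ (∀ i ∈ S', v i = y i)}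
        * Nat.card {v : D → F // v ∈ V}
      = Nat.card {v : D → F // v ∈ V ∧ ∀ i ∈ S, v i = x i}
        * Nat.card {v : D → F // v ∈ V ∧ ∀ i ∈ S', v i = y i} := by
  by_cases hx : ∃ a ∈ V, ∀ i ∈ S, a i = x i
  swap
  · have : IsEmpty {v : D → F // v ∈ V ∧ ∀ i ∈ S, v i = x i} := ⟨fun v => hx ⟨v, v.2⟩⟩
    have : IsEmpty {v : D → F // v ∈ V ∧ (∀ i ∈ S, v i = x i) ∧ (∀ i ∈ S', v i = y i)} :=
      ⟨fun v => hx ⟨v, v.2.1, v.2.2.1⟩⟩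
    simp
  by_cases hy : ∃ b ∈ V, ∀ i ∈ S', b i = y i
  swap
  · have : IsEmpty {v : D → F // v ∈ V ∧ ∀ i ∈ S', v i = y i} := ⟨fun v => hy ⟨v, v.2⟩⟩
    have : IsEmpty {v : D → F // v ∈ V ∧ (∀ i ∈ S, v i = x i) ∧ (∀ i ∈ S', v i = y i)} :=
      ⟨fun v => hy ⟨v, v.2.1, v.2.2.2⟩⟩
    simp
  obtain ⟨a, haV, ha⟩ := hx
  obtain ⟨b, hbV, hb⟩ := hy
  obtain ⟨k, hk, l, hl, hkl⟩ := Submodule.mem_sup.1 (hV (V.sub_mem haV hbV))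
  rw [mem_vanishingOn] at hk hl
  obtain ⟨u, hu⟩ : ∃ u, u = a - k := ⟨_, rfl⟩
  have hu' : u = b + l := by rw [hu, sub_eq_iff_eq_add, add_assoc, add_comm l, hkl]; abel
  have huV : u ∈ V := hu ▸ V.sub_mem haV hk.1
  have hux : ∀ i ∈ S, u i = x i := fun i hi => by simp [hu, hk.2 i hi, ha i hi]
  have huy : ∀ i ∈ S', u i = y i := fun i hi => by simp [hu', hl.2 i hi, hb i hi]
  have hsub (v : D → F) : v - u ∈ V ↔ v ∈ V := V.sub_mem_iff_left huV
  have hS (v : D → F) : (v ∈ V ∧ ∀ i ∈ S, v i = x i) ↔ v - u ∈ vanishingOn V S := by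
    rw [mem_vanishingOn, hsub]
    exact and_congr_right fun _ => forall₂_congr fun i hi => by
      rw [Pi.sub_apply, sub_eq_zero, hux i hi]
  have hS' (v : D → F) : (v ∈ V ∧ ∀ i ∈ S', v i = y i) ↔ v - u ∈ vanishingOn V S' := by
    rw [mem_vanishingOn, hsub]
    exact and_congr_right fun _ => forall₂_congr fun i hi => by
      rw [Pi.sub_apply, sub_eq_zero, huy i hi]
  have hSS' (v : D → F) : (v ∈ V ∧ (∀ i ∈ S, v i = x i) ∧ (∀ i ∈ S', v i = y i)) ↔
      v - u ∈ vanishingOn V S ⊓ vanishingOn V S' := by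
    rw [Submodule.mem_inf, ← hS, ← hS']
    tauto
  have hsup : vanishingOn V S ⊔ vanishingOn V S' = V :=
    le_antisymm (sup_le inf_le_left inf_le_left) hV
  have hcard := card_sup_mul_card_inf (vanishingOn V S) (vanishingOn V S')
  rw [hsup] at hcard
  rw [card_eq_card_of_iff_sub_mem _ u hS, card_eq_card_of_iff_sub_mem _ u hS',
    card_eq_card_of_iff_sub_mem _ u hSS', mul_comm]
  exact hcard

/-- Claim A.1 (`claim:linear-algebra-fact`): "linear independence equals statistical
independence". Let `V ⊆ F^D` be a subspace over a finite field `F` with `D` finite, and let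
`v` be uniformly random in `V`. The restrictions `v|_S` and `v|_{S'}` are statistically
dependent (i.e. NOT independent) if and only if there are coefficient vectors `c` (on `S`) and
`d` (on `S'`) such that the functional `w ↦ ∑_{i ∈ S} c_i w_i` is nonzero on `V` and agrees on
all of `V` with `w ↦ ∑_{i ∈ S'} d_i w_i`.  Probabilities are expressed as counting ratios for
the uniform measure on the finite set `V`. -/
theorem linear_independence_eq_statistical_independence
    (F : Type*) [Field F] [Fintype F] (D : Type*) [Fintype D]
    (V : Submodule F (D → F)) (S S' : Finset D) :
    (¬ ∀ x y : D → F,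
        ((Nat.card {v : D → F // v ∈ V ∧ (∀ i ∈ S, v i = x i) ∧ (∀ i ∈ S', v i = y i)} : ℚ)
          / (Nat.card {v : D → F // v ∈ V} : ℚ))
        = ((Nat.card {v : D → F // v ∈ V ∧ ∀ i ∈ S, v i = x i} : ℚ)
            / (Nat.card {v : D → F // v ∈ V} : ℚ))
          * ((Nat.card {v : D → F // v ∈ V ∧ ∀ i ∈ S', v i = y i} : ℚ)
            / (Nat.card {v : D → F // v ∈ V} : ℚ)))
    ↔ ∃ c d : D → F,
        (∃ w ∈ V, ∑ i ∈ S, c i * w i ≠ 0) ∧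
        (∀ w ∈ V, ∑ i ∈ S, c i * w i = ∑ i ∈ S', d i * w i) := by
  have hV : (Nat.card {v : D → F // v ∈ V} : ℚ) ≠ 0 :=
    Nat.cast_ne_zero.2 (Nat.card_pos (α := V)).ne'
  constructor
  · contrapose!
    intro h x y
    have hle : V ≤ vanishingOn V S ⊔ vanishingOn V S' := by
      by_contra hle
      obtain ⟨w, hwV, hw⟩ := SetLike.not_le_iff_exists.1 hle
      obtain ⟨f, hfw, hf⟩ := Submodule.exists_le_ker_of_notMem hw
      obtain ⟨c, hc⟩ := exists_coeff_of_vanishingOn_le_ker V S f (le_sup_left.trans hf)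
      obtain ⟨d, hd⟩ := exists_coeff_of_vanishingOn_le_ker V S' f (le_sup_right.trans hf)
      obtain ⟨u, huV, hu⟩ := h c d ⟨w, hwV, by rwa [hc w hwV]⟩
      exact hu ((hc u huV).trans (hd u huV).symm)
    have hcard : (_ : ℚ) = _ := congrArg Nat.cast (card_mul_card_eq_of_le_sup V S S' hle x y)
    push_cast at hcard
    rw [div_mul_div_comm, ← hcard, mul_div_mul_right _ _ hV]
  · rintro ⟨c, d, ⟨w, hwV, hw⟩, hcd⟩ hindep
    have hempty :
        IsEmpty {v : D → F // v ∈ V ∧ (∀ i ∈ S, v i = w i) ∧ (∀ i ∈ S', v i = (0 : D → F) i)} := by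
      refine ⟨fun ⟨v, hvV, hvS, hvS'⟩ => hw ?_⟩
      calc ∑ i ∈ S, c i * w i = ∑ i ∈ S, c i * v i :=
            Finset.sum_congr rfl fun i hi => by rw [hvS i hi]
        _ = ∑ i ∈ S', d i * v i := hcd v hvV
        _ = 0 := Finset.sum_eq_zero fun i hi => by rw [hvS' i hi, Pi.zero_apply, mul_zero]
    have : Nonempty {v : D → F // v ∈ V ∧ ∀ i ∈ S, v i = w i} := ⟨w, hwV, fun _ _ => rfl⟩
    have : Nonempty {v : D → F // v ∈ V ∧ ∀ i ∈ S', v i = (0 : D → F) i} :=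
      ⟨0, V.zero_mem, fun _ _ => rfl⟩
    have h := hindep w 0
    rw [Nat.card_of_isEmpty, Nat.cast_zero, zero_div] at h
    exact mul_ne_zero (div_ne_zero (Nat.cast_ne_zero.2 Nat.card_pos.ne') hV)
      (div_ne_zero (Nat.cast_ne_zero.2 Nat.card_pos.ne') hV) h.symm
end

section
/- Let F be a finite field, H a subset of F, m ≥ 1, and γ := Σ_{α ∈ H} α. Assume the characteristic of F divides |H|. Then for every multilinear polynomial P in F[X₁,…,X_m] (i.e., of individual degree at most 1 in each variable): Σ_{α ∈ H^m} P(α) = κ · γ^m, where κ ∈ F is the coefficient of the monomial X₁·X₂⋯X_m in P. -/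
open MvPolynomial Finset

/-- Summing a polynomial over a product grid reduces to power sums on the factors. -/
theorem MvPolynomial.sum_piFinset_eval {σ R : Type*} [Fintype σ] [DecidableEq σ] [CommSemiring R]
    (H : σ → Finset R) (P : MvPolynomial σ R) :
    ∑ α ∈ Fintype.piFinset H, eval α P
      = ∑ d ∈ P.support, P.coeff d * ∏ i, ∑ a ∈ H i, a ^ d i := by
  simp_rw [eval_eq', Finset.prod_univ_sum, Finset.mul_sum]
  exact Finset.sum_comm

/-- Theorem A.2 (`thm:multilinear-upper-bound`, second case): if the characteristic of the
finite field `F` divides `|H|`, then for every multilinear `m`-variate polynomial `P`,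
`∑_{α ∈ H^m} P(α) = κ · γ^m`, where `κ` is the coefficient of the monomial `X₁⋯X_m` in `P`
and `γ = ∑_{α ∈ H} α`. -/
theorem multilinear_sum_char_dvd
    (F : Type*) [Field F] [Fintype F] (H : Finset F) (m : ℕ) (hm : 1 ≤ m)
    (hchar : ringChar F ∣ H.card)
    (P : MvPolynomial (Fin m) F) (hP : ∀ i : Fin m, P.degreeOf i ≤ 1) :
    ∑ α ∈ Fintype.piFinset (fun _ : Fin m => H), MvPolynomial.eval α P
    = P.coeff (Finsupp.equivFunOnFinite.symm fun _ : Fin m => 1) * (∑ a ∈ H, a) ^ m := by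
  rw [MvPolynomial.sum_piFinset_eval,
    Finset.sum_eq_single (Finsupp.equivFunOnFinite.symm fun _ : Fin m => 1)]
  · simp
  · intro d hd hne
    obtain ⟨i, hi⟩ : ∃ i, d i ≠ 1 := by
      by_contra! h
      exact hne (Finsupp.ext h)
    have hdi : d i = 0 := by
      have := (degreeOf_le_iff.mp (hP i)) d hd
      lia
    rw [Finset.prod_eq_zero (Finset.mem_univ i), mul_zero]
    simpa [hdi] using (ringChar.spec F H.card).mpr hchar
  · intro h
    rw [notMem_support_iff.mp h, zero_mul]
end

section
/- Let F be a field, let H be a finite additive subgroup of F, and let m, d be positive integers with d < |H|. Let a₀ ∈ F denote the coefficient of the linear term X in the subspace polynomial Π_{h ∈ H} (X − h). Then for every m-variate polynomial P over F of individual degree at most d in each variable: Σ_{α ∈ H^m} P(α) = κ · a₀^m, where κ ∈ F is the coefficient of the monomial X₁^{|H|−1} · X₂^{|H|−1} ⋯ X_m^{|H|−1} in P. In particular, if the total degree of P is strictly less than m·(|H| − 1), then Σ_{α ∈ H^m} P(α) = 0. -/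
open MvPolynomial Finset

/-- The linear coefficient of the subspace polynomial of `H` is the product of the differences
`x - y` over `y ∈ H \ {x}`, for any fixed `x ∈ H`. -/
theorem coeff_one_prod_X_sub_C_eq_prod_erase {F : Type*} [Field F] [DecidableEq F] {H : Finset F}
    (hzero : (0 : F) ∈ H) (hadd : ∀ x ∈ H, ∀ y ∈ H, x + y ∈ H) (hneg : ∀ x ∈ H, -x ∈ H)
    {x : F} (hx : x ∈ H) :
    (∏ h ∈ H, ((Polynomial.X : Polynomial F) - Polynomial.C h)).coeff 1
      = ∏ y ∈ H.erase x, (x - y) := by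
  rw [← Finset.mul_prod_erase H _ hzero, Polynomial.C_0, sub_zero, Polynomial.coeff_X_mul,
    Polynomial.coeff_zero_prod]
  refine Finset.prod_bij' (fun h _ => x + h) (fun y _ => y - x) ?_ ?_ ?_ ?_ ?_
  · intro h hh
    rw [Finset.mem_erase] at hh ⊢
    exact ⟨by simpa using hh.1, hadd _ hx _ hh.2⟩
  · intro y hy
    rw [Finset.mem_erase] at hy ⊢
    exact ⟨sub_ne_zero.mpr hy.1, by simpa [sub_eq_add_neg] using hadd _ hy.2 _ (hneg _ hx)⟩
  · intro h _
    ring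
  · intro y _
    ring
  · intro h _
    simp

/-- Power sums over a finite additive subgroup, for exponents smaller than its cardinality. -/
theorem sum_pow_eq_ite_of_lt_card {F : Type*} [Field F] {H : Finset F}
    (hzero : (0 : F) ∈ H) (hadd : ∀ x ∈ H, ∀ y ∈ H, x + y ∈ H) (hneg : ∀ x ∈ H, -x ∈ H)
    {k : ℕ} (hk : k < #H) :
    ∑ x ∈ H, x ^ k = if k = #H - 1 then
      (∏ h ∈ H, ((Polynomial.X : Polynomial F) - Polynomial.C h)).coeff 1 else 0 := by
  classical
  set a := (∏ h ∈ H, ((Polynomial.X : Polynomial F) - Polynomial.C h)).coeff 1 with ha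
  have hprod : ∀ x ∈ H, ∏ y ∈ H.erase x, (x - y) = a := fun x hx =>
    (coeff_one_prod_X_sub_C_eq_prod_erase hzero hadd hneg hx).symm
  have ha0 : a ≠ 0 := by
    rw [← hprod 0 hzero]
    exact Finset.prod_ne_zero_iff.mpr fun y hy => sub_ne_zero.mpr (Finset.ne_of_mem_erase hy).symm
  have h := Lagrange.coeff_eq_sum (s := H) (v := id) Function.injective_id.injOn
    (P := (Polynomial.X : Polynomial F) ^ k) (by simpa using hk)
  have h' : ∑ x ∈ H, ((Polynomial.X : Polynomial F) ^ k).eval (id x) /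
      ∏ y ∈ H.erase x, (id x - id y) = (∑ x ∈ H, x ^ k) / a := by
    rw [Finset.sum_div]
    refine Finset.sum_congr rfl fun x hx => ?_
    simp [hprod x hx]
  rw [h', Polynomial.coeff_X_pow, eq_div_iff ha0] at h
  rw [← h]
  by_cases hk' : k = #H - 1 <;> simp [hk', eq_comm]

/-- Lemma A.6 (`lem:additive-group`): if `H` is a finite additive subgroup of a field `F`
(a finite subset containing `0`, closed under addition and negation) and `d < |H|`, then for
every `m`-variate polynomial `P` of individual degree at most `d`,
`∑_{α ∈ H^m} P(α) = κ · a₀^m`, where `κ` is the coefficient of `X₁^{|H|−1}⋯X_m^{|H|−1}` in `P`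
and `a₀` is the coefficient of the linear term of the subspace polynomial `∏_{h ∈ H} (X − h)`.
In particular, if the total degree of `P` is strictly less than `m·(|H|−1)`, the sum is `0`. -/
theorem additive_subgroup_sum
    (F : Type*) [Field F] (H : Finset F)
    (hzero : (0 : F) ∈ H)
    (hadd : ∀ x ∈ H, ∀ y ∈ H, x + y ∈ H)
    (hneg : ∀ x ∈ H, -x ∈ H)
    (m d : ℕ) (hm : 0 < m) (hd0 : 0 < d) (hd : d < H.card)
    (P : MvPolynomial (Fin m) F) (hP : ∀ i : Fin m, P.degreeOf i ≤ d) :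
    (∑ α ∈ Fintype.piFinset (fun _ : Fin m => H), MvPolynomial.eval α P
      = P.coeff (Finsupp.equivFunOnFinite.symm fun _ : Fin m => H.card - 1)
        * ((∏ h ∈ H, ((Polynomial.X : Polynomial F) - Polynomial.C h)).coeff 1) ^ m) ∧
    (P.totalDegree < m * (H.card - 1) →
      ∑ α ∈ Fintype.piFinset (fun _ : Fin m => H), MvPolynomial.eval α P = 0) := by
  have hsum : ∑ α ∈ Fintype.piFinset (fun _ : Fin m => H), MvPolynomial.eval α P
      = P.coeff (Finsupp.equivFunOnFinite.symm fun _ : Fin m => H.card - 1)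
        * ((∏ h ∈ H, ((Polynomial.X : Polynomial F) - Polynomial.C h)).coeff 1) ^ m := by
    simp_rw [MvPolynomial.eval_eq']
    rw [Finset.sum_comm]
    simp_rw [← Finset.mul_sum]
    rw [Finset.sum_eq_single (Finsupp.equivFunOnFinite.symm fun _ : Fin m => H.card - 1)]
    · rw [← Finset.prod_univ_sum (fun _ : Fin m => H) (fun i x =>
        x ^ (Finsupp.equivFunOnFinite.symm (fun _ : Fin m => H.card - 1)) i)]
      simp [sum_pow_eq_ite_of_lt_card hzero hadd hneg (Nat.sub_one_lt (Nat.ne_zero_of_lt hd))]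
    · intro e he hne
      obtain ⟨i, hi⟩ : ∃ i, e i ≠ H.card - 1 := by
        by_contra! hall
        exact hne (Finsupp.ext hall)
      rw [← Finset.prod_univ_sum (fun _ : Fin m => H) (fun i x => x ^ e i),
        Finset.prod_eq_zero (Finset.mem_univ i), mul_zero]
      rw [sum_pow_eq_ite_of_lt_card hzero hadd hneg
        (((monomial_le_degreeOf i he).trans (hP i)).trans_lt hd), if_neg hi]
    · intro h
      rw [MvPolynomial.notMem_support_iff.mp h, zero_mul]
  refine ⟨hsum, fun hdeg => ?_⟩
  rw [hsum, MvPolynomial.coeff_eq_zero_of_totalDegree_lt, zero_mul]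
  refine hdeg.trans_le (le_of_eq ?_)
  rw [← Finsupp.degree_apply, Finsupp.degree_eq_sum]
  simp
end
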